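/- arXiv:1612.07854 — 2 statements merged into one kernel-verified Lean document; each statement's English description precedes it below -/
import Mathlib

section
/- If the error locator Λ_E(x) = Π_{ℓ∈U_E}(x − β_ℓ) and |U_E| ≤ n − k_max, then for every i ∈ {1,…,L}: deg(Y⁽ⁱ⁾(x)·Λ_E(x) mod m(x)) < k⁽ⁱ⁾ + |U_E|. -/
open Polynomial

/-- If `Λ_E = ∏_{ℓ∈U_E} (x − β_ℓ)` and `|U_E| ≤ n − k_max`, then for every `i`,
`deg(Y⁽ⁱ⁾ Λ_E mod m) < k⁽ⁱ⁾ + |U_E|`, where `Y⁽ⁱ⁾ = C⁽ⁱ⁾ + E⁽ⁱ⁾`. -/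
theorem deg_Y_mul_errorLocator_mod_lt {F : Type*} [Field F] {L n : ℕ}
    (β : Fin n → F) (hβ : Function.Injective β)
    (c E : Fin L → F[X]) (k : Fin L → ℕ)
    (hc : ∀ i, (c i).degree < (k i : WithBot ℕ))
    (hkn : ∀ i, k i < n)
    (hE : ∀ i, (E i).degree < (n : WithBot ℕ))
    (U : Finset (Fin n))
    (hU : ∀ ℓ, ℓ ∈ U ↔ ∃ i, (E i).eval (β ℓ) ≠ 0)
    (hcard : U.card ≤ n - Finset.univ.sup k) :
    ∀ i, ((c i + E i) * (∏ ℓ ∈ U, (X - C (β ℓ))) % (∏ ℓ, (X - C (β ℓ)))).degree <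
      ((k i + U.card : ℕ) : WithBot ℕ) := by
  intro i
  have hm : (∏ ℓ, (X - C (β ℓ)) : F[X]).degree = n := by
    rw [degree_prod]; simp
  have hL : (∏ ℓ ∈ U, (X - C (β ℓ)) : F[X]).degree = U.card := by
    rw [degree_prod]; simp
  have hdvd : (∏ ℓ, (X - C (β ℓ)) : F[X]) ∣ E i * ∏ ℓ ∈ U, (X - C (β ℓ)) := by
    apply Finset.prod_dvd_of_coprime
    · intro a _ b _ hab
      exact pairwise_coprime_X_sub_C hβ hab
    · intro ℓ _
      by_cases h : ℓ ∈ U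
      · exact Dvd.dvd.mul_left (Finset.dvd_prod_of_mem (fun ℓ => X - C (β ℓ)) h) _
      · apply Dvd.dvd.mul_right
        rw [dvd_iff_isRoot]
        by_contra h'
        exact h ((hU ℓ).2 ⟨i, h'⟩)
  have hlt : (c i * ∏ ℓ ∈ U, (X - C (β ℓ))).degree < ((k i + U.card : ℕ) : WithBot ℕ) := by
    rw [degree_mul, hL, Nat.cast_add]
    exact WithBot.add_lt_add_right (WithBot.natCast_ne_bot _) (hc i)
  have hle : k i + U.card ≤ n := by
    have h1 : k i ≤ Finset.univ.sup k := Finset.le_sup (Finset.mem_univ i)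
    have h2 := hkn i
    have h3 : Finset.univ.sup k < n := (Finset.sup_lt_iff (by
      rw [bot_eq_zero]; omega)).2 (fun j _ => hkn j)
    omega
  have hm0 : (∏ ℓ, (X - C (β ℓ)) : F[X]) ≠ 0 := by
    intro h
    rw [h, degree_zero] at hm
    exact WithBot.natCast_ne_bot _ hm.symm
  rw [add_mul, add_mod, (EuclideanDomain.mod_eq_zero).2 hdvd, add_zero,
    (mod_eq_self_iff hm0).2 (by rw [hm]; exact hlt.trans_le (by exact_mod_cast hle))]
  exact hlt
end

section
/- Full-rank probability bound: if 0 < t ≤ L and X₁,…,X_t are independent uniformly distributed random vectors in F_q^L ∖ {0}, then the probability that X₁,…,X_t are linearly dependent is strictly less than q^{−L+t}/(q−1). -/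
lemma fullRank_aux (q Q : ℝ) (hq : 1 < q) (t : ℕ) :
    ∀ (_ : q ^ t ≤ Q), 
    (0 ≤ ∏ i ∈ Finset.range t, (Q - q ^ i)) ∧
    (∏ i ∈ Finset.range t, (Q - q ^ i)) ≤ (Q - 1) ^ t ∧
    (Q - 1) * (q - 1) * ((Q - 1) ^ t - ∏ i ∈ Finset.range t, (Q - q ^ i)) ≤
      (Q - 1) ^ t * (q ^ t - 1 - t * (q - 1)) := by
  induction t with
  | zero => intro h; simp
  | succ t ih =>
    intro h
    have h1 : q ^ t ≤ q ^ (t + 1) := pow_le_pow_right₀ hq.le (Nat.le_succ t)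
    have h2 : 1 ≤ q ^ t := one_le_pow₀ hq.le
    obtain ⟨a, b, c⟩ := ih (h1.trans h)
    rw [Finset.prod_range_succ]
    set P := ∏ i ∈ Finset.range t, (Q - q ^ i)
    have hQ : 0 ≤ Q - q ^ t := by linarith
    have hM : 0 ≤ Q - 1 := by linarith
    refine ⟨mul_nonneg a hQ, ?_, ?_⟩
    · rw [pow_succ]
      exact mul_le_mul b (by linarith) hQ (pow_nonneg hM t)
    · have e1 := mul_le_mul_of_nonneg_left c hM
      have e2 := mul_le_mul_of_nonneg_left b
        (mul_nonneg (mul_nonneg hM (sub_nonneg.2 hq.le)) (sub_nonneg.2 h2))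
      push_cast
      rw [pow_succ, pow_succ]
      linear_combination e1 + e2

/-- Full-rank probability bound: for `0 < t ≤ L`, the fraction of `t`-tuples of
nonzero vectors of `F_q^L` that are linearly dependent (out of `(q^L−1)^t` tuples)
is strictly less than `q^{−(L−t)}/(q−1)`; equivalently, writing `N` for the number
of linearly dependent tuples, `N · q^L · (q−1) < (q^L − 1)^t · q^t`. -/
theorem fullRank_probability_bound (F : Type*) [Field F] [Fintype F]
    (L t : ℕ) (ht : 0 < t) (htL : t ≤ L) :
    Nat.card {X : Fin t → {v : Fin L → F // v ≠ 0} //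
        ¬ LinearIndependent F (fun j => (X j : Fin L → F))} *
      Fintype.card F ^ L * (Fintype.card F - 1) <
    (Fintype.card F ^ L - 1) ^ t * Fintype.card F ^ t := by
  classical
  have hq : 1 < Fintype.card F := Fintype.one_lt_card
  have hI : Nat.card {X : Fin t → {v : Fin L → F // v ≠ 0} //
        LinearIndependent F (fun j => (X j : Fin L → F))} =
      ∏ i : Fin t, (Fintype.card F ^ L - Fintype.card F ^ (i : ℕ)) := by
    have h := card_linearIndependent (K := F) (V := Fin L → F) (k := t) (by simpa using htL)
    rw [Module.finrank_fin_fun] at h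
    rw [← h]
    exact Nat.card_congr
      { toFun := fun X => ⟨fun j => (X.1 j : Fin L → F), X.2⟩
        invFun := fun s => ⟨fun j => ⟨s.1 j, s.2.ne_zero j⟩, s.2⟩
        left_inv := fun _ => rfl
        right_inv := fun _ => rfl }
  have hT : Nat.card (Fin t → {v : Fin L → F // v ≠ 0}) = (Fintype.card F ^ L - 1) ^ t := by
    rw [Nat.card_eq_fintype_card, Fintype.card_fun, Fintype.card_fin]
    congr 1
    rw [Fintype.card_subtype_compl, Fintype.card_fun, Fintype.card_fin, Fintype.card_subtype_eq]
  have hsum := Nat.card_congr (Equiv.sumCompl (fun X : Fin t → {v : Fin L → F // v ≠ 0} =>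
    LinearIndependent F (fun j => (X j : Fin L → F))))
  rw [Nat.card_sum, hI, hT] at hsum
  generalize Nat.card {X : Fin t → {v : Fin L → F // v ≠ 0} //
        ¬ LinearIndependent F (fun j => (X j : Fin L → F))} = N at *
  generalize Fintype.card F = q at *
  rw [Fin.prod_univ_eq_prod_range (fun i => q ^ L - q ^ i) t] at hsum
  have hqL : 1 ≤ q ^ L := Nat.one_le_pow _ _ (by omega)
  have hq' : (1 : ℝ) < q := by exact_mod_cast hq
  have hQt : (q : ℝ) ^ t ≤ (q : ℝ) ^ L := pow_le_pow_right₀ hq'.le htL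
  have hs : (∏ i ∈ Finset.range t, ((q : ℝ) ^ L - (q : ℝ) ^ i)) + N = ((q : ℝ) ^ L - 1) ^ t := by
    have := congrArg (Nat.cast : ℕ → ℝ) hsum
    push_cast [Nat.cast_sub hqL] at this
    rw [← this]
    congr 1
    refine Finset.prod_congr rfl fun i hi => ?_
    rw [Nat.cast_sub (Nat.pow_le_pow_right (by omega) (by have := Finset.mem_range.1 hi; omega))]
    push_cast
    rfl
  obtain ⟨-, -, c⟩ := fullRank_aux q ((q : ℝ) ^ L) hq' t hQt
  rw [← eq_sub_iff_add_eq'] at hs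
  rw [← hs] at c
  have hQ1 : (1 : ℝ) < (q : ℝ) ^ L := one_lt_pow₀ hq' (by omega)
  have goal' : (N : ℝ) * (q : ℝ) ^ L * (q - 1) < ((q : ℝ) ^ L - 1) ^ t * (q : ℝ) ^ t := by
    have hM : 0 < (q : ℝ) ^ L - 1 := by linarith
    refine lt_of_mul_lt_mul_left ?_ hM.le
    have ht' : (1 : ℝ) ≤ t := by exact_mod_cast ht
    have hk : (q : ℝ) ^ L * ((q : ℝ) ^ t - 1 - t * (q - 1)) < ((q : ℝ) ^ L - 1) * (q : ℝ) ^ t := by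
      have : 0 < (q : ℝ) ^ L * (t * (q - 1)) := by
        have : (0 : ℝ) < q - 1 := by linarith
        positivity
      linarith
    have e1 := mul_le_mul_of_nonneg_left c (by linarith : 0 ≤ (q : ℝ) ^ L)
    have e2 := mul_lt_mul_of_pos_left hk (pow_pos hM t)
    linear_combination e1 + e2
  have : ((N * q ^ L * (q - 1) : ℕ) : ℝ) < (((q ^ L - 1) ^ t * q ^ t : ℕ) : ℝ) := by
    push_cast [Nat.cast_sub hqL, Nat.cast_sub hq.le]
    exact goal'
  exact_mod_cast this
end
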